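/- Let Λ ⊂ ℂ be a lattice with g₂(Λ) ≠ 0 and let c ∈ ℂ satisfy c² = g₂/12. If both c and -c are midpoint constants of Λ, then (since the three midpoint constants sum to zero) the midpoint constants are c, -c, 0, and the identity e₂e₃ + e₃e₁ + e₁e₂ = -g₂/4 forces -c² = -g₂/4, contradicting c² = g₂/12 with g₂ ≠ 0; hence ℘² - g₂/12 = (℘ - c)(℘ + c) has a simple zero and admits no meromorphic square-root on ℂ. -/

import Mathlib

open Complex Filter Topology Set

/-- The lattice `{2n₁ω₁ + 2n₂ω₂ : n₁, n₂ ∈ ℤ}` generated by `2ω₁` and `2ω₂`. -/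
def latticeSet (ω₁ ω₂ : ℂ) : Set ℂ :=
  {z | ∃ m n : ℤ, z = 2 * (m : ℂ) * ω₁ + 2 * (n : ℂ) * ω₂}

/-- The Weierstrass ℘-function of the lattice `Λ`:
`℘(z) = z⁻² + Σ_{0 ≠ λ ∈ Λ} ((z - λ)⁻² - λ⁻²)`. -/
noncomputable def wp (Λ : Set ℂ) (z : ℂ) : ℂ :=
  z ^ (-2 : ℤ) + ∑' l : {l : ℂ // l ∈ Λ ∧ l ≠ 0}, ((z - l) ^ (-2 : ℤ) - (l : ℂ) ^ (-2 : ℤ))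

/-- The invariant `g₃(Λ) = 140 Σ_{0 ≠ λ ∈ Λ} λ⁻⁶`. -/
noncomputable def g3 (Λ : Set ℂ) : ℂ :=
  140 * ∑' l : {l : ℂ // l ∈ Λ ∧ l ≠ 0}, (l : ℂ) ^ (-6 : ℤ)

/-- The invariant `g₂(Λ) = 60 Σ_{0 ≠ λ ∈ Λ} λ⁻⁴`. -/
noncomputable def g2 (Λ : Set ℂ) : ℂ :=
  60 * ∑' l : {l : ℂ // l ∈ Λ ∧ l ≠ 0}, (l : ℂ) ^ (-4 : ℤ)

/-- The fourth-order Eisenstein function `ζ₄(z) = Σ_{λ ∈ Λ} (z - λ)⁻⁴`. -/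
noncomputable def zeta4 (Λ : Set ℂ) (z : ℂ) : ℂ :=
  ∑' l : Λ, (z - (l : ℂ)) ^ (-4 : ℤ)

namespace PeriodPair

variable (L : PeriodPair)

/-- Liouville's theorem for elliptic functions without poles. -/
lemma exists_eventuallyEq_const_of_periodic {f : ℂ → ℂ} (hf : Meromorphic f)
    (hp : ∀ l ∈ L.lattice, f.Periodic l) (ho : ∀ z, 0 ≤ meromorphicOrderAt f z) :
    ∃ c, ∀ z, f =ᶠ[𝓝[≠] z] fun _ ↦ c := by
  choose g hg hfg using fun z ↦ (hf z).meromorphicOrderAt_nonneg_iff.1 (ho z)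
  let F : ℂ → ℂ := fun z ↦ limUnder (𝓝[≠] z) f
  have hFlim {z c : ℂ} (h : Tendsto f (𝓝[≠] z) (𝓝 c)) : F z = c := h.limUnder_eq
  have hlim (z : ℂ) : Tendsto f (𝓝[≠] z) (𝓝 (g z z)) :=
    (((hg z).continuousAt.tendsto).mono_left nhdsWithin_le_nhds).congr' (hfg z).symm
  have hFg (z : ℂ) : F =ᶠ[𝓝 z] g z := by
    have h1 : ∀ᶠ w in 𝓝[≠] z, F w = g z w := by
      filter_upwards [eventually_eventually_nhdsWithin.2 (hfg z),
        (hg z).eventually_analyticAt.filter_mono nhdsWithin_le_nhds,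
        self_mem_nhdsWithin] with w hw hw' hne
      have : f =ᶠ[𝓝 w] g z := by
        rwa [IsOpen.nhdsWithin_eq isOpen_compl_singleton hne] at hw
      exact hFlim ((hw'.continuousAt.tendsto.congr' this.symm).mono_left nhdsWithin_le_nhds)
    rw [eventually_nhdsWithin_iff] at h1
    filter_upwards [h1] with w hw
    rcases eq_or_ne w z with rfl | hne
    · exact hFlim (hlim w)
    · exact hw hne
  have hFd : Differentiable ℂ F := fun z ↦
    ((hg z).congr (hFg z).symm).differentiableAt
  have hFp (z l : ℂ) (hl : l ∈ L.lattice) : F (z + l) = F z := by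
    refine hFlim ?_
    have h := (hlim z)
    rw [← hFlim h] at h
    have h2 : Tendsto (fun w ↦ w - l) (𝓝[≠] (z + l)) (𝓝[≠] z) := by
      refine tendsto_nhdsWithin_iff.2 ⟨?_, ?_⟩
      · refine Tendsto.mono_left ?_ nhdsWithin_le_nhds
        have : ContinuousAt (fun w ↦ w - l) (z + l) := by fun_prop
        simpa [ContinuousAt] using this
      · filter_upwards [self_mem_nhdsWithin] with w hw hw'
        exact hw (by simp at hw' ⊢; rw [← hw']; ring)
    refine (h.comp h2).congr fun w ↦ ?_
    simpa using (hp l hl (w - l)).symm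
  have hconst (z : ℂ) : F z = F 0 :=
    hFd.apply_eq_apply_of_bounded (IsZLattice.isCompact_range_of_periodic L.lattice _
      hFd.continuous fun z w hw ↦ hFp z w hw).isBounded z 0
  refine ⟨F 0, fun z ↦ ?_⟩
  filter_upwards [hfg z, (hFg z).filter_mono nhdsWithin_le_nhds] with w h1 h2
  rw [h1, ← h2, hconst]

lemma order_weierstrassP_sub_const {l : ℂ} (hl : l ∈ L.lattice) (c : ℂ) :
    meromorphicOrderAt (fun z ↦ ℘[L] z - c) l = -2 := by
  have : (fun z ↦ ℘[L] z - c) = ℘[L] + fun _ ↦ -c := by ext; simp [sub_eq_add_neg]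
  have h : AnalyticAt ℂ (fun _ : ℂ ↦ -c) l := analyticAt_const
  rw [this, meromorphicOrderAt_add_eq_left_of_lt h.meromorphicAt, L.order_weierstrassP l hl]
  rw [L.order_weierstrassP l hl]
  exact lt_of_lt_of_le (by decide) h.meromorphicOrderAt_nonneg

lemma meromorphic_weierstrassP_sub_const (c : ℂ) : Meromorphic (fun z ↦ ℘[L] z - c) :=
  fun z ↦ (L.meromorphic_weierstrassP z).sub (MeromorphicAt.const c z)

lemma exists_weierstrassP_eq (c : ℂ) : ∃ z ∉ L.lattice, ℘[L] z = c := by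
  by_contra! H
  obtain ⟨a, ha⟩ := L.exists_eventuallyEq_const_of_periodic (f := (fun z ↦ ℘[L] z - c)⁻¹)
    (fun z ↦ (L.meromorphic_weierstrassP_sub_const c z).inv)
    (fun l hl z ↦ by simp [L.periodic_weierstrassP ⟨l, hl⟩ z])
    (fun z ↦ by
      rw [meromorphicOrderAt_inv]
      by_cases hz : z ∈ L.lattice
      · rw [L.order_weierstrassP_sub_const hz]; decide
      · have h : AnalyticAt ℂ (fun z ↦ ℘[L] z - c) z :=
          (L.analyticOnNhd_weierstrassP z hz).sub analyticAt_const
        rw [h.meromorphicOrderAt_eq, h.analyticOrderAt_eq_zero.2 (sub_ne_zero.2 (H z hz))]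
        simp)
  have h0 : Tendsto (fun z ↦ ℘[L] z - c)⁻¹ (𝓝[≠] 0) (𝓝 0) := by
    refine tendsto_zero_of_meromorphicOrderAt_pos ?_
    rw [meromorphicOrderAt_inv, L.order_weierstrassP_sub_const L.lattice.zero_mem]
    decide
  have ha0 : a = 0 := tendsto_nhds_unique (tendsto_const_nhds.congr' (ha 0).symm) h0
  have hw := L.ω₁_div_two_notMem_lattice
  have h1 := (ha (L.ω₁ / 2)).and
    ((L.isClosed_lattice.isOpen_compl.eventually_mem hw).filter_mono nhdsWithin_le_nhds)
  obtain ⟨z, hz, hz'⟩ := h1.exists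
  subst ha0
  exact H z hz' (sub_eq_zero.1 (inv_eq_zero.1 hz))

lemma derivWeierstrassP_half {h : ℂ} (hh : 2 * h ∈ L.lattice) : ℘'[L] h = 0 := by
  have h1 := L.derivWeierstrassP_sub_coe h ⟨_, hh⟩
  have h2 : h - 2 * h = -h := by ring
  simp only [h2, derivWeierstrassP_neg] at h1
  exact CharZero.eq_neg_self_iff.1 h1.symm

lemma two_le_order_weierstrassP_sub_const {z : ℂ} (hz : z ∉ L.lattice) (hz2 : 2 * z ∈ L.lattice) :
    2 ≤ meromorphicOrderAt (fun w ↦ ℘[L] w - ℘[L] z) z := by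
  have hP := L.analyticOnNhd_weierstrassP z hz
  have h : AnalyticAt ℂ (fun w ↦ ℘[L] w - ℘[L] z) z := hP.sub analyticAt_const
  have h1 : (1 : ℕ∞) ≤ analyticOrderAt (deriv ℘[L]) z := by
    rw [Order.one_le_iff_ne_zero, hP.deriv.analyticOrderAt_ne_zero, deriv_weierstrassP,
      L.derivWeierstrassP_half hz2]
  have h2 : (2 : ℕ∞) ≤ analyticOrderAt (fun w ↦ ℘[L] w - ℘[L] z) z := by
    rw [← hP.analyticOrderAt_deriv_add_one, ← one_add_one_eq_two]
    gcongr
  rw [h.meromorphicOrderAt_eq]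
  cases hn : analyticOrderAt (fun w ↦ ℘[L] w - ℘[L] z) z with
  | top => simp
  | coe n =>
    rw [hn] at h2
    rw [ENat.map_natCast]
    have h3 : (2 : ℤ) ≤ n := by exact_mod_cast h2
    exact WithTop.coe_le_coe.2 h3

/-- `℘` takes its value at a half period only at the translates of that half period. -/
lemma sub_mem_lattice_of_weierstrassP_eq {h w : ℂ} (hh : h ∉ L.lattice) (hh2 : 2 * h ∈ L.lattice)
    (hw : w ∉ L.lattice) (heq : ℘[L] w = ℘[L] h) : w - h ∈ L.lattice := by
  by_contra hwh
  have hm := L.meromorphic_weierstrassP_sub_const (℘[L] h)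
  set f : ℂ → ℂ := fun z ↦ ℘[L] z - ℘[L] h with hf
  have hfp (l : ℂ) (hl : l ∈ L.lattice) : f.Periodic l := fun z ↦ by
    simp [hf, L.periodic_weierstrassP ⟨l, hl⟩ z]
  have ht (z : ℂ) : meromorphicOrderAt f z ≠ ⊤ :=
    MeromorphicOn.meromorphicOrderAt_ne_top_of_isPreconnected (U := univ) (fun z _ ↦ hm z)
      isPreconnected_univ (mem_univ 0) (mem_univ z)
      (by rw [L.order_weierstrassP_sub_const L.lattice.zero_mem]; decide)
  have hms (z : ℂ) : MeromorphicAt (f ∘ (· - h)) z := by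
    simpa [sub_eq_add_neg] using (meromorphicAt_comp_add_const_iff_meromorphicAt (c := -h)).2
      (hm (z + -h))
  have hord (z : ℂ) : meromorphicOrderAt (f * f ∘ (· - h)) z =
      meromorphicOrderAt f z + meromorphicOrderAt f (z - h) := by
    rw [meromorphicOrderAt_mul (hm z) (hms z),
      meromorphicOrderAt_comp_sub_const_eq_meromorphicOrderAt]
  have han (z : ℂ) (hz : z ∉ L.lattice) : AnalyticAt ℂ f z :=
    (L.analyticOnNhd_weierstrassP z hz).sub analyticAt_const
  have hperiodhalf (z : ℂ) (hz : z - h ∈ L.lattice) : ℘[L] z = ℘[L] h := by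
    simpa using L.weierstrassP_add_coe h ⟨_, hz⟩
  have hhalf (z : ℂ) (hz : z - h ∈ L.lattice) : 2 ≤ meromorphicOrderAt f z := by
    rw [hf, ← hperiodhalf z hz]
    refine L.two_le_order_weierstrassP_sub_const (fun hz' ↦ hh ?_) ?_
    · simpa using L.lattice.sub_mem hz' hz
    · have := L.lattice.add_mem (L.lattice.add_mem hz hz) hh2
      convert this using 1
      ring
  obtain ⟨c, hc⟩ := L.exists_eventuallyEq_const_of_periodic (f := f * f ∘ (· - h))
    (fun z ↦ (hm z).mul (hms z))
    (fun l hl z ↦ by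
      have h1 := hfp l hl z
      have h2 := hfp l hl (z - h)
      have h3 : z + l - h = z - h + l := by ring
      simp [h1, h3, h2])
    (fun z ↦ by
      rw [hord]
      by_cases hz : z ∈ L.lattice
      · rw [L.order_weierstrassP_sub_const hz]
        have := hhalf (z - h) (by
          have := L.lattice.sub_mem hz hh2
          convert this using 1
          ring)
        calc (0 : WithTop ℤ) = -2 + 2 := by decide
          _ ≤ _ := by gcongr
      · by_cases hz' : z - h ∈ L.lattice
        · rw [L.order_weierstrassP_sub_const hz']
          calc (0 : WithTop ℤ) = 2 + -2 := by decide
            _ ≤ _ := by gcongr; exact hhalf z hz'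
        · exact add_nonneg (han z hz).meromorphicOrderAt_nonneg
            (han _ hz').meromorphicOrderAt_nonneg)
  have hc0 : c = 0 := by
    have h1 : AnalyticAt ℂ (f * f ∘ (· - h)) w :=
      (han w hw).mul ((han _ hwh).comp_of_eq (by fun_prop) rfl)
    have h2 := h1.continuousAt.tendsto.mono_left (nhdsWithin_le_nhds (s := {w}ᶜ))
    have h3 := tendsto_nhds_unique (tendsto_const_nhds.congr' (hc w).symm) h2
    simpa [hf, heq] using h3
  subst hc0
  have h0 : meromorphicOrderAt (f * f ∘ (· - h)) 0 = ⊤ := meromorphicOrderAt_eq_top_iff.2 (hc 0)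
  rw [hord, WithTop.add_eq_top] at h0
  exact h0.elim (ht _) (ht _)

lemma midpoint_relations {h₁ h₂ : ℂ} (h1 : L.ω₁ = 2 * h₁) (h2 : L.ω₂ = 2 * h₂) :
    ℘[L] h₁ + ℘[L] h₂ + ℘[L] (-h₁ - h₂) = 0 ∧
    ℘[L] h₂ * ℘[L] (-h₁ - h₂) + ℘[L] (-h₁ - h₂) * ℘[L] h₁ + ℘[L] h₁ * ℘[L] h₂ = -L.g₂ / 4 ∧
    ℘[L] h₁ * ℘[L] h₂ * ℘[L] (-h₁ - h₂) = L.g₃ / 4 := by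
  have notMem (x : ℂ) (α β : ℚ) (hx : α * L.ω₁ + β * L.ω₂ = x) (h : ¬ (α.den = 1 ∧ β.den = 1)) :
      x ∉ L.lattice :=
    hx ▸ fun H ↦ h (mul_ω₁_add_mul_ω₂_mem_lattice.1 H)
  have n1 : h₁ ∉ L.lattice := notMem _ (1 / 2) 0 (by rw [h1]; push_cast; ring) (by norm_num)
  have n2 : h₂ ∉ L.lattice := notMem _ 0 (1 / 2) (by rw [h2]; push_cast; ring) (by norm_num)
  have n3 : -h₁ - h₂ ∉ L.lattice :=
    notMem _ (-1 / 2) (-1 / 2) (by rw [h1, h2]; push_cast; ring) (by norm_num)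
  have n12 : h₁ - h₂ ∉ L.lattice :=
    notMem _ (1 / 2) (-1 / 2) (by rw [h1, h2]; push_cast; ring) (by norm_num)
  have n31 : -h₁ - h₂ - h₁ ∉ L.lattice :=
    notMem _ (-1) (-1 / 2) (by rw [h1, h2]; push_cast; ring) (by norm_num)
  have n32 : -h₁ - h₂ - h₂ ∉ L.lattice :=
    notMem _ (-1 / 2) (-1) (by rw [h1, h2]; push_cast; ring) (by norm_num)
  have m1 : 2 * h₁ ∈ L.lattice := h1 ▸ L.ω₁_mem_lattice
  have m2 : 2 * h₂ ∈ L.lattice := h2 ▸ L.ω₂_mem_lattice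
  have m3 : 2 * (-h₁ - h₂) ∈ L.lattice := by
    have := L.lattice.neg_mem (L.lattice.add_mem m1 m2)
    convert this using 1
    ring
  have d12 : ℘[L] h₁ - ℘[L] h₂ ≠ 0 := fun h ↦
    n12 (L.sub_mem_lattice_of_weierstrassP_eq n2 m2 n1 (sub_eq_zero.1 h))
  have d31 : ℘[L] (-h₁ - h₂) - ℘[L] h₁ ≠ 0 := fun h ↦
    n31 (L.sub_mem_lattice_of_weierstrassP_eq n1 m1 n3 (sub_eq_zero.1 h))
  have d32 : ℘[L] (-h₁ - h₂) - ℘[L] h₂ ≠ 0 := fun h ↦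
    n32 (L.sub_mem_lattice_of_weierstrassP_eq n2 m2 n3 (sub_eq_zero.1 h))
  have r1 := L.derivWeierstrassP_sq _ n1
  have r2 := L.derivWeierstrassP_sq _ n2
  have r3 := L.derivWeierstrassP_sq _ n3
  rw [L.derivWeierstrassP_half m1] at r1
  rw [L.derivWeierstrassP_half m2] at r2
  rw [L.derivWeierstrassP_half m3] at r3
  generalize ℘[L] h₁ = a at *
  generalize ℘[L] h₂ = b at *
  generalize ℘[L] (-h₁ - h₂) = c at *
  have q12 : 4 * (a ^ 2 + a * b + b ^ 2) - L.g₂ = 0 :=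
    mul_left_cancel₀ d12 (by linear_combination r2 - r1)
  have q32 : 4 * (c ^ 2 + c * b + b ^ 2) - L.g₂ = 0 :=
    mul_left_cancel₀ d32 (by linear_combination r2 - r3)
  have hs : a + b + c = 0 := mul_left_cancel₀ d31 (by linear_combination (q32 - q12) / 4)
  have hp : b * c + c * a + a * b = -L.g₂ / 4 := by
    linear_combination (a + b) * hs - q12 / 4
  refine ⟨hs, hp, ?_⟩
  linear_combination a * hp - r1 / 4 - a ^ 2 * hs

/-- The period pair `(2ω₁, 2ω₂)` with half periods `ω₁` and `ω₂`. -/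
def ofHalfPeriods {ω₁ ω₂ : ℂ} (h : LinearIndependent ℝ ![ω₁, ω₂]) : PeriodPair where
  ω₁ := 2 * ω₁
  ω₂ := 2 * ω₂
  indep := by
    rw [LinearIndependent.pair_iff] at h ⊢
    intro s t hst
    refine h s t ?_
    simp only [Complex.real_smul] at hst ⊢
    linear_combination hst / 2

end PeriodPair

lemma latticeSet_eq_lattice {ω₁ ω₂ : ℂ} (h : LinearIndependent ℝ ![ω₁, ω₂]) :
    latticeSet ω₁ ω₂ = (PeriodPair.ofHalfPeriods h).lattice := by
  ext z
  rw [SetLike.mem_coe, PeriodPair.mem_lattice]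
  refine exists_congr fun m ↦ exists_congr fun n ↦ ?_
  simp only [PeriodPair.ofHalfPeriods]
  constructor <;> intro h <;> linear_combination -h

lemma tsum_subtype_eq_add_tsum_ne_zero {f : ℂ → ℂ} {S : Set ℂ} (h0 : 0 ∈ S)
    (hf : Summable fun l : S ↦ f l) :
    ∑' l : S, f l = f 0 + ∑' l : {l : ℂ // l ∈ S ∧ l ≠ 0}, f l := by
  have h := (hasSum_subtype_iff_indicator (s := S).1 hf.hasSum).summable
  rw [tsum_subtype S f, h.tsum_eq_add_tsum_ite 0, indicator_of_mem h0]
  congr 1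
  change _ = ∑' l : ({l : ℂ | l ∈ S ∧ l ≠ 0} : Set ℂ), f l
  rw [tsum_subtype]
  congr 1 with l
  simp only [indicator, mem_ofPred_eq]
  grind

open PeriodPair

lemma wp_lattice (L : PeriodPair) : wp L.lattice = ℘[L] := by
  ext z
  have := tsum_subtype_eq_add_tsum_ne_zero (S := L.lattice)
    (f := fun l ↦ 1 / (z - l) ^ 2 - 1 / l ^ 2) L.lattice.zero_mem (L.hasSum_weierstrassP z).summable
  rw [weierstrassP]
  refine Eq.trans ?_ this.symm
  simp [wp, zpow_neg, zpow_ofNat]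

lemma g2_lattice (L : PeriodPair) : g2 L.lattice = L.g₂ := by
  have hs := (L.hasSum_sumInvPow 0 (r := 4) (by norm_num)).summable
  have := tsum_subtype_eq_add_tsum_ne_zero (S := L.lattice)
    (f := fun l ↦ (l ^ 4)⁻¹) L.lattice.zero_mem (by simpa using hs)
  rw [PeriodPair.g₂, G]
  refine Eq.trans ?_ (congrArg (60 * ·) this.symm)
  simp [g2, zpow_neg, zpow_ofNat]

/-- Three numbers with sum zero and second elementary symmetric function `-g / 4 ≠ 0` do not
include both square roots of `g / 12`. -/
lemma not_mem_and_neg_mem_of_sum_eq_zero {a b d c g : ℂ} (hsum : a + b + d = 0)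
    (hpair : b * d + d * a + a * b = -g / 4) (hc : c ^ 2 = g / 12) (hc0 : c ≠ 0) :
    ¬ (c ∈ ({a, b, d} : Set ℂ) ∧ -c ∈ ({a, b, d} : Set ℂ)) := by
  simp only [mem_insert_iff, mem_singleton_iff]
  grind

/-- If `g₂(Λ) ≠ 0` and `c² = g₂/12`, then `c` and `-c` cannot both be midpoint constants of
`Λ`; hence `℘² - g₂/12` has a simple zero and admits no global meromorphic square-root. -/
theorem stmt16 (ω₁ ω₂ : ℂ) (hindep : LinearIndependent ℝ ![ω₁, ω₂]) (c : ℂ)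
    (hg₂ : g2 (latticeSet ω₁ ω₂) ≠ 0) (hc : c ^ 2 = g2 (latticeSet ω₁ ω₂) / 12) :
    ¬ (c ∈ ({wp (latticeSet ω₁ ω₂) ω₁, wp (latticeSet ω₁ ω₂) ω₂,
          wp (latticeSet ω₁ ω₂) (-ω₁ - ω₂)} : Set ℂ) ∧
        -c ∈ ({wp (latticeSet ω₁ ω₂) ω₁, wp (latticeSet ω₁ ω₂) ω₂,
          wp (latticeSet ω₁ ω₂) (-ω₁ - ω₂)} : Set ℂ)) ∧
    (∃ z ∉ latticeSet ω₁ ω₂,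
      (wp (latticeSet ω₁ ω₂) z) ^ 2 - g2 (latticeSet ω₁ ω₂) / 12 = 0 ∧
      deriv (fun w => (wp (latticeSet ω₁ ω₂) w) ^ 2 - g2 (latticeSet ω₁ ω₂) / 12) z ≠ 0) ∧
    ¬ ∃ f : ℂ → ℂ, MeromorphicOn f Set.univ ∧
      ∀ z ∉ latticeSet ω₁ ω₂,
        f z ^ 2 = (wp (latticeSet ω₁ ω₂) z) ^ 2 - g2 (latticeSet ω₁ ω₂) / 12 := by
  let L : PeriodPair := .ofHalfPeriods hindep
  have hmem : ∀ z, z ∈ latticeSet ω₁ ω₂ ↔ z ∈ L.lattice := fun z ↦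
    Set.ext_iff.1 (latticeSet_eq_lattice hindep) z
  have hwp : wp (latticeSet ω₁ ω₂) = ℘[L] := by
    rw [latticeSet_eq_lattice hindep, wp_lattice]
  have hg : g2 (latticeSet ω₁ ω₂) = L.g₂ := by
    rw [latticeSet_eq_lattice hindep, g2_lattice]
  simp only [hwp, hg, hmem] at *
  obtain ⟨hsum, hpair, hprod⟩ := L.midpoint_relations (h₁ := ω₁) (h₂ := ω₂) rfl rfl
  have hc0 : c ≠ 0 := by
    rintro rfl
    apply hg₂
    linear_combination (-12) * hc
  have hnot := not_mem_and_neg_mem_of_sum_eq_zero hsum hpair hc hc0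
  have hsimple : ∃ z ∉ L.lattice, ℘[L] z ^ 2 - L.g₂ / 12 = 0 ∧
      deriv (fun w ↦ ℘[L] w ^ 2 - L.g₂ / 12) z ≠ 0 := by
    obtain ⟨a, ha2, hae⟩ : ∃ a : ℂ, a ^ 2 = L.g₂ / 12 ∧
        a ∉ ({℘[L] ω₁, ℘[L] ω₂, ℘[L] (-ω₁ - ω₂)} : Set ℂ) := by
      rw [not_and_or] at hnot
      exact hnot.elim (fun h ↦ ⟨c, hc, h⟩) (fun h ↦ ⟨-c, by rw [neg_sq, hc], h⟩)
    obtain ⟨z, hz, rfl⟩ := L.exists_weierstrassP_eq a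
    refine ⟨z, hz, by rw [ha2, sub_self], ?_⟩
    have hP := (L.analyticOnNhd_weierstrassP z hz).differentiableAt
    have hd : deriv (fun w ↦ ℘[L] w ^ 2 - L.g₂ / 12) z = 2 * ℘[L] z * ℘'[L] z := by
      rw [deriv_sub_const, deriv_fun_pow hP, L.deriv_weierstrassP]
      simp
    have hP0 : ℘[L] z ≠ 0 := by
      intro h
      apply hg₂
      rw [h] at ha2
      linear_combination (-12) * ha2
    have hsq : ℘'[L] z ^ 2 = 4 * ((℘[L] z - ℘[L] ω₁) * (℘[L] z - ℘[L] ω₂) *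
        (℘[L] z - ℘[L] (-ω₁ - ω₂))) := by
      rw [L.derivWeierstrassP_sq z hz]
      linear_combination 4 * ℘[L] z ^ 2 * hsum - 4 * ℘[L] z * hpair + 4 * hprod
    simp only [mem_insert_iff, mem_singleton_iff, not_or] at hae
    have hP' : ℘'[L] z ≠ 0 := by
      rw [← pow_ne_zero_iff two_ne_zero, hsq]
      simp [sub_eq_zero, hae]
    rw [hd]
    simp [hP0, hP']
  refine ⟨hnot, hsimple, ?_⟩
  rintro ⟨f, hf, hfsq⟩
  obtain ⟨z, hz, hz0, hz1⟩ := hsimple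
  have han : AnalyticAt ℂ (fun w ↦ ℘[L] w ^ 2 - L.g₂ / 12) z :=
    ((L.analyticOnNhd_weierstrassP z hz).pow 2).sub analyticAt_const
  have hord : meromorphicOrderAt (f ^ 2) z = 1 := by
    rw [meromorphicOrderAt_congr (f₂ := fun w ↦ ℘[L] w ^ 2 - L.g₂ / 12),
      han.meromorphicOrderAt_eq, han.analyticOrderAt_eq_one_of_zero_deriv_ne_zero hz0 hz1]
    · simp
    · filter_upwards [(L.isClosed_lattice.isOpen_compl.eventually_mem hz).filter_mono
        nhdsWithin_le_nhds] with w hw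
      exact hfsq w hw
  rw [meromorphicOrderAt_pow (hf z (mem_univ z))] at hord
  cases hn : meromorphicOrderAt f z with
  | top => simp [hn] at hord
  | coe n =>
    rw [hn] at hord
    have : (2 : ℤ) * n = 1 := by
      rw [← WithTop.coe_inj, WithTop.coe_mul]
      exact hord
    omega
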